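/- Let K be a 1-symmetric convex body in ℝ^n and let N_K(x) = ‖x‖₂ / vol_{n-1}(K ∩ x^⊥) for x ≠ 0, N_K(0) = 0. Then N_K is nondecreasing in each coordinate on ℝ₊^n: if x, y ∈ ℝ₊^n satisfy x_j ≤ y_j for all j, then N_K(x) ≤ N_K(y). In particular, max_{x ∈ [0,1]^n} N_K(x) = N_K(1,…,1). -/

import Mathlib

open MeasureTheory Finset
open scoped Classical

/-- The (n-1)-dimensional Hausdorff measure of the central hyperplane section
`K ∩ x^⊥`. -/
noncomputable def sectVol (n : ℕ) (K : Set (EuclideanSpace ℝ (Fin n)))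
    (a : EuclideanSpace ℝ (Fin n)) : ℝ :=
  (Measure.hausdorffMeasure ((n : ℝ) - 1)
    (K ∩ {x : EuclideanSpace ℝ (Fin n) | inner ℝ x a = (0 : ℝ)})).toReal

/-- Busemann's function `N_K(x) = ‖x‖₂ / vol_{n-1}(K ∩ x^⊥)`, with `N_K(0) = 0`. -/
noncomputable def NK (n : ℕ) (K : Set (EuclideanSpace ℝ (Fin n)))
    (x : EuclideanSpace ℝ (Fin n)) : ℝ :=
  if x = 0 then 0 else ‖x‖ / sectVol n K x

/-- `K` is 1-symmetric: symmetric about every coordinate hyperplane and invariant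
under permutations of the coordinates. -/
def IsOneSymmetric (n : ℕ) (K : Set (EuclideanSpace ℝ (Fin n))) : Prop :=
  (∀ j : Fin n, ∀ x ∈ K,
      (WithLp.toLp 2 (fun i => if i = j then -(x i) else x i) : EuclideanSpace ℝ (Fin n)) ∈ K) ∧
  ∀ σ : Equiv.Perm (Fin n), ∀ x ∈ K,
      (WithLp.toLp 2 (fun i => x (σ i)) : EuclideanSpace ℝ (Fin n)) ∈ K

open scoped ENNReal Pointwise

lemma volume_iSup_nonempty_compact {A : Set ℝ} (hA : MeasurableSet A) (hne : A.Nonempty) :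
    volume A = ⨆ (S : Set ℝ) (_ : S ⊆ A ∧ IsCompact S ∧ S.Nonempty), volume S := by
  apply le_antisymm
  · obtain ⟨a, ha⟩ := hne
    rw [hA.measure_eq_iSup_isCompact]
    refine iSup_le fun S => iSup_le fun hS => iSup_le fun hc => ?_
    refine le_trans (measure_mono (Set.subset_insert a S)) ?_
    exact le_iSup₂_of_le (insert a S)
      ⟨Set.insert_subset ha hS, hc.insert a, Set.insert_nonempty a S⟩ le_rfl
  · exact iSup₂_le fun S hS => measure_mono hS.1

/-- The Brunn–Minkowski inequality on the line, for compact sets. -/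
lemma brunn_minkowski_real_of_isCompact {A B C : Set ℝ} (hA : IsCompact A) (hB : IsCompact B)
    (hAne : A.Nonempty) (hBne : B.Nonempty) {p q : ℝ} (hp : 0 < p) (hq : 0 < q)
    (h : ∀ a ∈ A, ∀ b ∈ B, p * a + q * b ∈ C) :
    ENNReal.ofReal p * volume A + ENNReal.ofReal q * volume B ≤ volume C := by
  obtain ⟨a₀, ha₀, hmax⟩ := hA.exists_isGreatest hAne
  obtain ⟨b₀, hb₀, hmin⟩ := hB.exists_isLeast hBne
  have hvA : volume ((q * b₀) +ᵥ p • A) = ENNReal.ofReal p * volume A := by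
    rw [measure_vadd, Measure.addHaar_smul]; simp [abs_of_pos hp]
  have hvB : volume ((p * a₀) +ᵥ q • B) = ENNReal.ofReal q * volume B := by
    rw [measure_vadd, Measure.addHaar_smul]; simp [abs_of_pos hq]
  rw [← hvA, ← hvB, ← measure_union₀ ((hB.smul q).vadd _).measurableSet.nullMeasurableSet]
  · apply measure_mono
    rintro _ (⟨_, ⟨a, ha, rfl⟩, rfl⟩ | ⟨_, ⟨b, hb, rfl⟩, rfl⟩)
    · simpa [add_comm] using h a ha b₀ hb₀
    · simpa using h a₀ ha₀ b hb
  · refine measure_mono_null (t := {p * a₀ + q * b₀}) ?_ (by simp)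
    rintro _ ⟨⟨_, ⟨a, ha, rfl⟩, rfl⟩, ⟨_, ⟨b, hb, rfl⟩, hab⟩⟩
    have h1 := hmax ha
    have h2 := hmin hb
    simp only [vadd_eq_add, smul_eq_mul, Set.mem_singleton_iff] at hab ⊢
    nlinarith

/-- The Brunn–Minkowski inequality on the line. -/
lemma brunn_minkowski_real {A B C : Set ℝ} (hA : MeasurableSet A) (hB : MeasurableSet B)
    (hAne : A.Nonempty) (hBne : B.Nonempty) {p q : ℝ} (hp : 0 < p) (hq : 0 < q)
    (h : ∀ a ∈ A, ∀ b ∈ B, p * a + q * b ∈ C) :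
    ENNReal.ofReal p * volume A + ENNReal.ofReal q * volume B ≤ volume C := by
  rw [volume_iSup_nonempty_compact hA hAne, volume_iSup_nonempty_compact hB hBne]
  simp only [ENNReal.mul_iSup]
  obtain ⟨a, ha⟩ := hAne
  obtain ⟨b, hb⟩ := hBne
  refine ENNReal.biSup_add_biSup_le' ⟨{a}, by simpa⟩ ⟨{b}, by simpa⟩ ?_
  rintro S ⟨hSA, hSc, hSn⟩ T ⟨hTB, hTc, hTn⟩
  exact brunn_minkowski_real_of_isCompact hSc hTc hSn hTn hp hq
    fun a ha b hb => h a (hSA ha) b (hTB hb)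

lemma ENNReal.rpow_mul_rpow_le_add (a b : ℝ≥0∞) {p q : ℝ} (hp : 0 < p) (hq : 0 < q)
    (hpq : p + q = 1) :
    a ^ p * b ^ q ≤ ENNReal.ofReal p * a + ENNReal.ofReal q * b := by
  have hp' : ENNReal.ofReal p ≠ 0 := by simpa
  have hq' : ENNReal.ofReal q ≠ 0 := by simpa
  rcases eq_or_ne a ⊤ with rfl | ha
  · simp [ENNReal.mul_top hp']
  rcases eq_or_ne b ⊤ with rfl | hb
  · simp [ENNReal.mul_top hq']
  lift a to NNReal using ha
  lift b to NNReal using hb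
  have := NNReal.geom_mean_le_arith_mean2_weighted p.toNNReal q.toNNReal a b
    (by rw [← Real.toNNReal_add hp.le hq.le, hpq, Real.toNNReal_one])
  rw [Real.coe_toNNReal p hp.le, Real.coe_toNNReal q hq.le] at this
  rw [← ENNReal.coe_rpow_of_nonneg _ hp.le, ← ENNReal.coe_rpow_of_nonneg _ hq.le]
  simp only [ENNReal.ofReal]
  exact_mod_cast this

/-- Layer cake formula for functions bounded by `1`. -/
lemma lintegral_eq_lintegral_meas_lt_of_le_one {f : ℝ → ℝ≥0∞} (hf : Measurable f)
    (h1 : ∀ x, f x ≤ 1) :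
    ∫⁻ x, f x = ∫⁻ t in Set.Ioi (0 : ℝ), volume {x | ENNReal.ofReal t < f x} := by
  have hne : ∀ x, f x ≠ ⊤ := fun x => ne_top_of_le_ne_top ENNReal.one_ne_top (h1 x)
  have := lintegral_eq_lintegral_meas_lt volume (f := fun x => (f x).toReal)
    (Filter.Eventually.of_forall fun x => ENNReal.toReal_nonneg) hf.ennreal_toReal.aemeasurable
  simp only [ENNReal.ofReal_toReal (hne _)] at this
  rw [this]
  refine setLIntegral_congr_fun measurableSet_Ioi fun t ht => ?_
  simp only [ENNReal.ofReal_lt_iff_lt_toReal (le_of_lt ht) (hne _)]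

lemma prekopa_leindler_real_of_iSup_eq_one {f g h : ℝ → ℝ≥0∞} (hf : Measurable f)
    (hg : Measurable g) (hh : Measurable h) (hfs : ⨆ x, f x = 1) (hgs : ⨆ x, g x = 1)
    {p q : ℝ} (hp : 0 < p) (hq : 0 < q) (hpq : p + q = 1)
    (H : ∀ x y, f x ^ p * g y ^ q ≤ h (p * x + q * y)) :
    (∫⁻ x, f x) ^ p * (∫⁻ x, g x) ^ q ≤ ∫⁻ x, h x := by
  refine (ENNReal.rpow_mul_rpow_le_add _ _ hp hq hpq).trans ?_
  have hf1 : ∀ x, f x ≤ 1 := fun x => hfs ▸ le_iSup f x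
  have hg1 : ∀ x, g x ≤ 1 := fun x => hgs ▸ le_iSup g x
  refine le_trans ?_ (lintegral_mono fun x => min_le_left (h x) 1)
  rw [lintegral_eq_lintegral_meas_lt_of_le_one hf hf1,
    lintegral_eq_lintegral_meas_lt_of_le_one hg hg1,
    lintegral_eq_lintegral_meas_lt_of_le_one (hh.min measurable_const) (fun x => min_le_right _ _),
    ← lintegral_const_mul' _ _ ENNReal.ofReal_ne_top,
    ← lintegral_const_mul' _ _ ENNReal.ofReal_ne_top]
  refine (le_lintegral_add _ _).trans ?_
  refine setLIntegral_mono' measurableSet_Ioi fun t ht => ?_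
  rcases le_or_gt 1 t with h1 | h1
  · have h1' : (1 : ℝ≥0∞) ≤ ENNReal.ofReal t := by simpa using h1
    simp [fun x => not_lt.2 ((hf1 x).trans h1'), fun x => not_lt.2 ((hg1 x).trans h1')]
  have h1' : ENNReal.ofReal t < 1 := by simpa using h1
  have hAne : {x | ENNReal.ofReal t < f x}.Nonempty := by
    rw [← hfs, lt_iSup_iff] at h1'
    exact h1'
  have hBne : {x | ENNReal.ofReal t < g x}.Nonempty := by
    rw [← hgs, lt_iSup_iff] at h1'
    exact h1'
  refine brunn_minkowski_real (measurableSet_lt measurable_const hf)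
    (measurableSet_lt measurable_const hg) hAne hBne hp hq fun a ha b hb => ?_
  refine lt_min (lt_of_lt_of_le ?_ (H a b)) h1'
  calc ENNReal.ofReal t = ENNReal.ofReal t ^ p * ENNReal.ofReal t ^ q := by
        rw [← ENNReal.rpow_add_of_nonneg _ _ hp.le hq.le, hpq, ENNReal.rpow_one]
    _ < f a ^ p * g b ^ q :=
        ENNReal.mul_lt_mul (ENNReal.rpow_lt_rpow ha hp) (ENNReal.rpow_lt_rpow hb hq)

lemma prekopa_leindler_real_of_iSup_ne_top {f g h : ℝ → ℝ≥0∞} (hf : Measurable f)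
    (hg : Measurable g) (hh : Measurable h) (hfs : ⨆ x, f x ≠ ⊤) (hgs : ⨆ x, g x ≠ ⊤)
    {p q : ℝ} (hp : 0 < p) (hq : 0 < q) (hpq : p + q = 1)
    (H : ∀ x y, f x ^ p * g y ^ q ≤ h (p * x + q * y)) :
    (∫⁻ x, f x) ^ p * (∫⁻ x, g x) ^ q ≤ ∫⁻ x, h x := by
  rcases eq_or_ne (⨆ x, f x) 0 with hf0 | hf0
  · simp [ENNReal.iSup_eq_zero.1 hf0, hp]
  rcases eq_or_ne (⨆ x, g x) 0 with hg0 | hg0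
  · simp [ENNReal.iSup_eq_zero.1 hg0, hq]
  set S := ⨆ x, f x
  set T := ⨆ x, g x
  have hSi : S⁻¹ ≠ ⊤ := ENNReal.inv_ne_top.2 hf0
  have hTi : T⁻¹ ≠ ⊤ := ENNReal.inv_ne_top.2 hg0
  have key := prekopa_leindler_real_of_iSup_eq_one (f := fun x => S⁻¹ * f x)
    (g := fun x => T⁻¹ * g x) (h := fun x => (S⁻¹ ^ p * T⁻¹ ^ q) * h x)
    (hf.const_mul _) (hg.const_mul _) (hh.const_mul _)
    (by rw [← ENNReal.mul_iSup]; exact ENNReal.inv_mul_cancel hf0 hfs)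
    (by rw [← ENNReal.mul_iSup]; exact ENNReal.inv_mul_cancel hg0 hgs) hp hq hpq
    (fun x y => by
      rw [ENNReal.mul_rpow_of_nonneg _ _ hp.le, ENNReal.mul_rpow_of_nonneg _ _ hq.le,
        mul_mul_mul_comm]
      gcongr
      exact H x y)
  have hc : S⁻¹ ^ p * T⁻¹ ^ q ≠ ⊤ :=
    ENNReal.mul_ne_top (ENNReal.rpow_ne_top_of_nonneg hp.le hSi)
      (ENNReal.rpow_ne_top_of_nonneg hq.le hTi)
  have hc0 : S⁻¹ ^ p * T⁻¹ ^ q ≠ 0 := by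
    simp [hfs, hgs, hp.le, hq.le, hp, hq]
  rw [lintegral_const_mul' _ _ hSi, lintegral_const_mul' _ _ hTi, lintegral_const_mul' _ _ hc,
    ENNReal.mul_rpow_of_nonneg _ _ hp.le, ENNReal.mul_rpow_of_nonneg _ _ hq.le,
    mul_mul_mul_comm] at key
  exact (ENNReal.mul_le_mul_iff_right hc0 hc).1 key

lemma tendsto_lintegral_min_natCast {f : ℝ → ℝ≥0∞} (hf : Measurable f) :
    Filter.Tendsto (fun n : ℕ => ∫⁻ x, min (f x) n) Filter.atTop (nhds (∫⁻ x, f x)) := by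
  refine lintegral_tendsto_of_tendsto_of_monotone
    (fun n => (hf.min measurable_const).aemeasurable)
    (Filter.Eventually.of_forall fun x m n hmn => by dsimp only; gcongr)
    (Filter.Eventually.of_forall fun x => ?_)
  simpa using (tendsto_const_nhds (x := f x)).min ENNReal.tendsto_nat_nhds_top

/-- The Prékopa–Leindler inequality on the line. -/
lemma prekopa_leindler_real {f g h : ℝ → ℝ≥0∞} (hf : Measurable f)
    (hg : Measurable g) (hh : Measurable h)
    {p q : ℝ} (hp : 0 < p) (hq : 0 < q) (hpq : p + q = 1)
    (H : ∀ x y, f x ^ p * g y ^ q ≤ h (p * x + q * y)) :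
    (∫⁻ x, f x) ^ p * (∫⁻ x, g x) ^ q ≤ ∫⁻ x, h x := by
  have key : ∀ m n : ℕ, (∫⁻ x, min (f x) m) ^ p * (∫⁻ x, min (g x) n) ^ q ≤ ∫⁻ x, h x := by
    intro m n
    refine prekopa_leindler_real_of_iSup_ne_top (hf.min measurable_const)
      (hg.min measurable_const) hh ?_ ?_ hp hq hpq fun x y => le_trans ?_ (H x y)
    · exact ne_top_of_le_ne_top (ENNReal.natCast_ne_top m) (iSup_le fun x => min_le_right _ _)
    · exact ne_top_of_le_ne_top (ENNReal.natCast_ne_top n) (iSup_le fun x => min_le_right _ _)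
    · gcongr <;> exact min_le_left _ _
  have hsup : ∀ {f : ℝ → ℝ≥0∞}, Measurable f → ∀ {r : ℝ}, 0 < r →
      (∫⁻ x, f x) ^ r = ⨆ n : ℕ, (∫⁻ x, min (f x) n) ^ r := by
    intro f hf r hr
    refine tendsto_nhds_unique
      ((ENNReal.continuous_rpow_const.tendsto _).comp (tendsto_lintegral_min_natCast hf))
      (tendsto_atTop_iSup fun m n hmn => ?_)
    exact ENNReal.rpow_le_rpow
      (lintegral_mono fun x => min_le_min_left _ (Nat.cast_le.2 hmn)) hr.le
  rw [hsup hf hp, hsup hg hq, ENNReal.iSup_mul]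
  refine iSup_le fun m => ?_
  rw [ENNReal.mul_iSup]
  exact iSup_le fun n => key m n

/-- The Prékopa–Leindler inequality for partial integrals over the coordinates in `s`, at points
which agree on the coordinate `j ∉ s`. -/
lemma prekopa_leindler_lmarginal {ι : Type*} [DecidableEq ι] {f g h : (ι → ℝ) → ℝ≥0∞}
    (hf : Measurable f) (hg : Measurable g) (hh : Measurable h)
    {p q : ℝ} (hp : 0 < p) (hq : 0 < q) (hpq : p + q = 1) (j : ι)
    (H : ∀ x y, x j = y j → f x ^ p * g y ^ q ≤ h (p • x + q • y))
    (s : Finset ι) (hj : j ∉ s) (x y : ι → ℝ) (hxy : x j = y j) :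
    lmarginal (fun _ => volume) s f x ^ p * lmarginal (fun _ => volume) s g y ^ q ≤
      lmarginal (fun _ => volume) s h (p • x + q • y) := by
  induction s using Finset.induction generalizing x y with
  | empty => simpa using H x y hxy
  | insert i s hi ih =>
    rw [lmarginal_insert _ hf hi, lmarginal_insert _ hg hi, lmarginal_insert _ hh hi]
    have hij : j ≠ i := fun h => hj (h ▸ Finset.mem_insert_self _ _)
    refine prekopa_leindler_real ((hf.lmarginal _).comp (measurable_update _))
      ((hg.lmarginal _).comp (measurable_update _)) ((hh.lmarginal _).comp (measurable_update _))
      hp hq hpq fun a b => ?_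
    refine (ih (fun h => hj (Finset.mem_insert_of_mem h)) (Function.update x i a)
      (Function.update y i b) (by simp [hij, hxy])).trans_eq ?_
    congr 1
    ext k
    by_cases hk : k = i
    · subst hk; simp
    · simp [hk]

lemma lmarginal_neg {ι : Type*} [DecidableEq ι] {f : (ι → ℝ) → ℝ≥0∞}
    (hf : ∀ x, f (-x) = f x) (s : Finset ι) (x : ι → ℝ) :
    lmarginal (fun _ => volume) s f (-x) = lmarginal (fun _ => volume) s f x := by
  unfold lmarginal
  rw [← lintegral_neg_eq_self]
  refine lintegral_congr fun y => ?_
  rw [← hf]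
  congr 1
  ext k
  by_cases hk : k ∈ s <;> simp [Function.updateFinset, hk]

/-- The parametrization `z ↦ (z, -⟨a, z⟩)` of a hyperplane as a graph over the coordinates other
than `i`. -/
noncomputable def hyperplaneGraph {m : ℕ} (i : Fin (m + 1)) (a : Fin m → ℝ) :
    (Fin m → ℝ) →ₗ[ℝ] EuclideanSpace ℝ (Fin (m + 1)) where
  toFun z := WithLp.toLp 2 (i.insertNth (-(∑ k, a k * z k)) z)
  map_add' z w := by
    ext l
    refine i.succAboveCases ?_ (fun k => ?_) l
    · simp [mul_add, Finset.sum_add_distrib, add_comm]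
    · simp
  map_smul' c z := by
    ext l
    refine i.succAboveCases ?_ (fun k => ?_) l
    · simp [Finset.mul_sum, mul_left_comm]
    · simp

section hyperplaneGraph

variable {m : ℕ} (i : Fin (m + 1)) (a : Fin m → ℝ)

@[simp] lemma hyperplaneGraph_apply_same (z : Fin m → ℝ) :
    hyperplaneGraph i a z i = -(∑ k, a k * z k) := by
  simp [hyperplaneGraph]

@[simp] lemma hyperplaneGraph_apply_succAbove (z : Fin m → ℝ) (k : Fin m) :
    hyperplaneGraph i a z (i.succAbove k) = z k := by
  simp [hyperplaneGraph]

lemma continuous_hyperplaneGraph : Continuous (hyperplaneGraph i a) :=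
  LinearMap.continuous_of_finiteDimensional _

lemma euclidean_ext_succAbove {x y : EuclideanSpace ℝ (Fin (m + 1))} (hi : x i = y i)
    (h : ∀ k, x (i.succAbove k) = y (i.succAbove k)) : x = y := by
  ext l
  exact i.succAboveCases hi h l

lemma inner_hyperplaneGraph (z w : Fin m → ℝ) :
    inner ℝ (hyperplaneGraph i a z) (hyperplaneGraph i a w) =
      (∑ k, a k * z k) * (∑ k, a k * w k) + ∑ k, z k * w k := by
  simp [PiLp.inner_apply, i.sum_univ_succAbove, mul_comm]

end hyperplaneGraph

lemma IsOneSymmetric.neg_mem {n : ℕ} {K : Set (EuclideanSpace ℝ (Fin n))}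
    (hK : IsOneSymmetric n K) {x : EuclideanSpace ℝ (Fin n)} (hx : x ∈ K) : -x ∈ K := by
  have key : ∀ s : Finset (Fin n), (WithLp.toLp 2 (fun i => if i ∈ s then -(x i) else x i) :
      EuclideanSpace ℝ (Fin n)) ∈ K := by
    intro s
    induction s using Finset.induction with
    | empty => simpa using hx
    | insert j s hj ih =>
      convert hK.1 j _ ih using 2
      ext i
      by_cases hij : i = j
      · subst hij; simp [hj]
      · simp [hij]
  convert key Finset.univ using 1
  ext i
  simp

lemma IsOneSymmetric.zero_mem_interior {n : ℕ} {K : Set (EuclideanSpace ℝ (Fin n))}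
    (hK : IsOneSymmetric n K) (hconv : Convex ℝ K) (hK_ne : (interior K).Nonempty) :
    0 ∈ interior K := by
  obtain ⟨x, hx⟩ := hK_ne
  have hneg : Homeomorph.neg (EuclideanSpace ℝ (Fin n)) ⁻¹' K = K := Set.Subset.antisymm
    (fun y hy => by simpa using hK.neg_mem hy) (fun y hy => hK.neg_mem hy)
  have hx' : -x ∈ interior K := by
    have h := (Homeomorph.neg (EuclideanSpace ℝ (Fin n))).preimage_interior K
    rw [hneg] at h
    rwa [← h] at hx
  have := hconv.interior hx hx' (a := 1 / 2) (b := 1 / 2) (by norm_num) (by norm_num) (by norm_num)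
  simpa using this

/-- The volume of the projection of a hyperplane section along a coordinate direction decreases
in each coefficient of the hyperplane. -/
lemma volume_preimage_hyperplaneGraph_anti {m : ℕ} {K : Set (EuclideanSpace ℝ (Fin (m + 1)))}
    (hclosed : IsClosed K) (hconv : Convex ℝ K) (hsym : IsOneSymmetric (m + 1) K)
    (i : Fin (m + 1)) {a b : Fin m → ℝ} (j : Fin m) (hab : ∀ k, k ≠ j → b k = a k)
    (hb : 0 ≤ b j) (hba : b j ≤ a j) :
    volume (hyperplaneGraph i a ⁻¹' K) ≤ volume (hyperplaneGraph i b ⁻¹' K) := by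
  rcases hba.eq_or_lt with heq | hlt
  · rw [show b = a from funext fun k => by
      by_cases hk : k = j
      · rw [hk, heq]
      · exact hab k hk]
  have ha : 0 < a j := hb.trans_lt hlt
  set flip : (Fin m → ℝ) → (Fin m → ℝ) := fun z => Function.update z j (-(z j)) with hflip
  set p : ℝ := (1 + b j / a j) / 2 with hp
  set q : ℝ := (1 - b j / a j) / 2 with hq
  have hp0 : 0 < p := by positivity
  have hq0 : 0 < q := by
    have : b j / a j < 1 := (div_lt_one ha).2 hlt
    simp only [hq]; linarith
  have hpq : p + q = 1 := by simp only [hp, hq]; ring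
  have hpqa : p * a j - q * a j = b j := by simp only [hp, hq]; field_simp; ring
  have hmeas : ∀ c : Fin m → ℝ, MeasurableSet (hyperplaneGraph i c ⁻¹' K) := fun c =>
    (hclosed.preimage (continuous_hyperplaneGraph i c)).measurableSet
  have hind : ∀ c : Fin m → ℝ,
      Measurable ((hyperplaneGraph i c ⁻¹' K).indicator (1 : (Fin m → ℝ) → ℝ≥0∞)) := fun c =>
    measurable_one.indicator (hmeas c)
  rw [← lintegral_indicator_one (hmeas a), ← lintegral_indicator_one (hmeas b)]
  refine lintegral_le_of_lmarginal_le (Finset.univ.erase j) (hind a) (hind b) fun x => ?_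
  have hmem : ∀ c z : Fin m → ℝ, hyperplaneGraph i c z ∈ K →
      hyperplaneGraph i (flip c) (flip z) ∈ K := by
    intro c z hz
    convert hsym.1 (i.succAbove j) _ hz using 1
    refine euclidean_ext_succAbove i ?_ fun k => ?_
    · rw [hyperplaneGraph_apply_same]
      simp only [(Fin.succAbove_ne i j).symm, if_false, hyperplaneGraph_apply_same]
      congr 1
      refine Finset.sum_congr rfl fun k _ => ?_
      by_cases hk : k = j
      · subst hk; simp [hflip]
      · simp [hflip, hk]
    · by_cases hk : k = j
      · subst hk; simp [hflip]
      · simp [hflip, hk]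
  have hflip2 : ∀ z, flip (flip z) = z := fun z => by simp [hflip]
  have hg : ∀ z, (hyperplaneGraph i (flip a) ⁻¹' K).indicator (1 : (Fin m → ℝ) → ℝ≥0∞) z =
      (hyperplaneGraph i a ⁻¹' K).indicator 1 (flip z) := by
    intro z
    have : z ∈ hyperplaneGraph i (flip a) ⁻¹' K ↔ flip z ∈ hyperplaneGraph i a ⁻¹' K :=
      ⟨fun h => by simpa only [hflip2, Set.mem_preimage] using hmem _ _ h,
        fun h => by simpa only [hflip2, Set.mem_preimage] using hmem _ _ h⟩
    simp only [Set.indicator, this]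
    rfl
  have hfneg : ∀ z, (hyperplaneGraph i a ⁻¹' K).indicator (1 : (Fin m → ℝ) → ℝ≥0∞) (-z) =
      (hyperplaneGraph i a ⁻¹' K).indicator 1 z := by
    intro z
    have : -z ∈ hyperplaneGraph i a ⁻¹' K ↔ z ∈ hyperplaneGraph i a ⁻¹' K := by
      simp only [Set.mem_preimage, map_neg]
      exact ⟨fun h => by simpa using hsym.neg_mem h, fun h => hsym.neg_mem h⟩
    simp only [Set.indicator, this]
    rfl
  have hmarg : lmarginal (fun _ => volume) (Finset.univ.erase j)
      ((hyperplaneGraph i (flip a) ⁻¹' K).indicator (1 : (Fin m → ℝ) → ℝ≥0∞)) x =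
      lmarginal (fun _ => volume) (Finset.univ.erase j)
      ((hyperplaneGraph i a ⁻¹' K).indicator (1 : (Fin m → ℝ) → ℝ≥0∞)) x := by
    rw [← lmarginal_neg hfneg, lmarginal_congr (x := -x) (y := flip x) _ _ (by simp [hflip])]
    unfold lmarginal
    refine lintegral_congr fun y => ?_
    rw [hg]
    congr 1
    ext k
    by_cases hk : k = j
    · subst hk; simp [hflip, Function.updateFinset]
    · simp [hflip, hk, Function.updateFinset]
  have key := prekopa_leindler_lmarginal (hind a) (hind (flip a)) (hind b) hp0 hq0 hpq j ?_
    (Finset.univ.erase j) (by simp) x x rfl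
  · rw [hmarg, ← ENNReal.rpow_add_of_nonneg _ _ hp0.le hq0.le, hpq, ENNReal.rpow_one,
      ← add_smul, hpq, one_smul] at key
    exact key
  · intro z w hzw
    by_cases hz : z ∈ hyperplaneGraph i a ⁻¹' K
    swap
    · simp [hz, hp0]
    by_cases hw : w ∈ hyperplaneGraph i (flip a) ⁻¹' K
    swap
    · simp [hw, hq0]
    have hzw' : p • z + q • w ∈ hyperplaneGraph i b ⁻¹' K := by
      have hcomb := hconv hz hw hp0.le hq0.le hpq
      rw [Set.mem_preimage]
      convert hcomb using 1
      refine euclidean_ext_succAbove i ?_ fun k => by simp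
      simp only [hyperplaneGraph_apply_same, PiLp.add_apply, PiLp.smul_apply, smul_eq_mul,
        Pi.add_apply, Pi.smul_apply, mul_neg, ← neg_add, Finset.mul_sum,
        ← Finset.sum_add_distrib]
      congr 1
      refine Finset.sum_congr rfl fun k _ => ?_
      by_cases hk : k = j
      · subst hk
        simp only [hflip, Function.update_self, ← hpqa, hzw]
        ring
      · simp only [hflip, Function.update_of_ne hk, hab k hk]
        ring
    simp [hz, hw, hzw']

lemma norm_eq_mul_sqrt_succAbove {m : ℕ} {i : Fin (m + 1)} {x : EuclideanSpace ℝ (Fin (m + 1))}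
    (hx : 0 < x i) :
    ‖x‖ = x i * √(1 + ∑ k, (x (i.succAbove k) / x i) ^ 2) := by
  have hsum : ∑ l, ‖x l‖ ^ 2 = x i ^ 2 * (1 + ∑ k, (x (i.succAbove k) / x i) ^ 2) := by
    rw [i.sum_univ_succAbove, mul_add, Finset.mul_sum]
    simp only [Real.norm_eq_abs, sq_abs, mul_one]
    congr 1
    refine Finset.sum_congr rfl fun k _ => ?_
    field_simp
  rw [EuclideanSpace.norm_eq, hsum, Real.sqrt_mul (sq_nonneg _), Real.sqrt_sq hx.le]

/-- A square matrix with Gram matrix `1 + a aᵀ` has determinant `±√(1 + |a|²)`. -/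
lemma abs_det_eq_sqrt_of_gram {m : ℕ} (M : Matrix (Fin m) (Fin m) ℝ) (a : Fin m → ℝ)
    (h : M.transpose * M = 1 + Matrix.vecMulVec a a) :
    |M.det| = √(1 + ∑ k, a k ^ 2) := by
  have hdet := congrArg Matrix.det h
  rw [Matrix.det_mul, Matrix.det_transpose, Matrix.vecMulVec_eq Unit,
    Matrix.det_one_add_replicateCol_mul_replicateRow] at hdet
  rw [← Real.sqrt_mul_self_eq_abs, hdet]
  simp [dotProduct, sq]

/-- The Hausdorff measure of a hyperplane section in terms of the volume of its projection along
a coordinate direction. -/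
lemma exists_hausdorffMeasure_section_eq (m : ℕ) :
    ∃ c : NNReal, 0 < c ∧ ∀ (K : Set (EuclideanSpace ℝ (Fin (m + 1)))) (i : Fin (m + 1))
      (x : EuclideanSpace ℝ (Fin (m + 1))), 0 < x i →
      Measure.hausdorffMeasure (m : ℝ)
        (K ∩ {y : EuclideanSpace ℝ (Fin (m + 1)) | inner ℝ y x = (0 : ℝ)}) =
      c * ENNReal.ofReal (√(1 + ∑ k, (x (i.succAbove k) / x i) ^ 2)) *
        volume (hyperplaneGraph i (fun k => x (i.succAbove k) / x i) ⁻¹' K) := by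
  have hHaar : Measure.IsAddHaarMeasure
      (Measure.hausdorffMeasure (m : ℝ) : Measure (EuclideanSpace ℝ (Fin m))) := by
    have := isAddHaarMeasure_hausdorffMeasure (E := EuclideanSpace ℝ (Fin m))
    rwa [finrank_euclideanSpace_fin] at this
  refine ⟨Measure.addHaarScalarFactor
    (Measure.hausdorffMeasure (m : ℝ) : Measure (EuclideanSpace ℝ (Fin m))) volume,
    Measure.addHaarScalarFactor_pos_of_isAddHaarMeasure _ _, fun K i x hx => ?_⟩
  set a : Fin m → ℝ := fun k => x (i.succAbove k) / x i with ha
  have hx0 : x ≠ 0 := fun h => by simp [h] at hx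
  have : Fact (Module.finrank ℝ (EuclideanSpace ℝ (Fin (m + 1))) = m + 1) := ⟨by simp⟩
  set e := (OrthonormalBasis.fromOrthogonalSpanSingleton (𝕜 := ℝ) m hx0).repr
  set T : EuclideanSpace ℝ (Fin m) →ₗᵢ[ℝ] EuclideanSpace ℝ (Fin (m + 1)) :=
    (Submodule.subtypeₗᵢ _).comp e.symm.toLinearIsometry with hT
  have hperp : ∀ z, hyperplaneGraph i a z ∈ (Submodule.span ℝ {x})ᗮ := by
    intro z
    rw [Submodule.mem_orthogonal_singleton_iff_inner_left]
    simp only [PiLp.inner_apply, i.sum_univ_succAbove, hyperplaneGraph_apply_same,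
      hyperplaneGraph_apply_succAbove, RCLike.inner_apply, conj_trivial, ha]
    rw [mul_neg, Finset.mul_sum, neg_add_eq_zero]
    refine Finset.sum_congr rfl fun k _ => ?_
    field_simp
  set A : (Fin m → ℝ) →ₗ[ℝ] (Fin m → ℝ) :=
    (WithLp.linearEquiv 2 ℝ (Fin m → ℝ)).toLinearMap ∘ₗ e.toLinearEquiv.toLinearMap ∘ₗ
      (hyperplaneGraph i a).codRestrict _ hperp with hA
  have hTA : ∀ z, T (WithLp.toLp 2 (A z)) = hyperplaneGraph i a z := by
    intro z
    simp [hT, hA]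
  have hdet : |LinearMap.det A| = √(1 + ∑ k, a k ^ 2) := by
    rw [← LinearMap.det_toMatrix']
    refine abs_det_eq_sqrt_of_gram _ a ?_
    ext k l
    have h1 : inner ℝ (WithLp.toLp 2 (A (Pi.single k 1))) (WithLp.toLp 2 (A (Pi.single l 1))) =
        inner ℝ (hyperplaneGraph i a (Pi.single k 1)) (hyperplaneGraph i a (Pi.single l 1)) := by
      rw [← hTA, ← hTA, T.inner_map_map]
    rw [inner_hyperplaneGraph] at h1
    simp only [PiLp.inner_apply, RCLike.inner_apply, conj_trivial] at h1
    simp only [Matrix.mul_apply, Matrix.transpose_apply, LinearMap.toMatrix'_apply,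
      Matrix.add_apply, Matrix.vecMulVec_apply, Matrix.one_apply]
    simp only [mul_comm] at h1 ⊢
    rw [h1]
    simp [Pi.single_apply, add_comm, eq_comm, mul_comm]
  have hrange : K ∩ {y : EuclideanSpace ℝ (Fin (m + 1)) | inner ℝ y x = (0 : ℝ)} =
      T '' (T ⁻¹' K) := by
    rw [Set.image_preimage_eq_inter_range]
    congr 1
    ext y
    rw [Set.mem_ofPred_eq, ← Submodule.mem_orthogonal_singleton_iff_inner_left]
    constructor
    · intro hy
      exact ⟨e ⟨y, hy⟩, by simp [hT]⟩
    · rintro ⟨z, rfl⟩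
      exact (e.symm z).2
  have hpos : 0 < √(1 + ∑ k, a k ^ 2) := by
    have : 0 ≤ ∑ k, a k ^ 2 := Finset.sum_nonneg fun k _ => sq_nonneg _
    positivity
  have hdet0 : LinearMap.det A ≠ 0 := abs_pos.1 (hdet ▸ hpos)
  have hpre : hyperplaneGraph i a ⁻¹' K = A ⁻¹' (WithLp.toLp 2 ⁻¹' (T ⁻¹' K)) := by
    ext z
    simp only [Set.mem_preimage, hTA]
  rw [hrange, T.isometry.hausdorffMeasure_image (Or.inl (Nat.cast_nonneg m)), hpre,
    Measure.addHaar_preimage_linearMap _ hdet0, abs_inv, hdet, mul_assoc, ← mul_assoc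
      (ENNReal.ofReal _), ← ENNReal.ofReal_mul hpos.le, mul_inv_cancel₀ hpos.ne',
    ENNReal.ofReal_one, one_mul]
  have hvol : volume (WithLp.toLp 2 ⁻¹' (T ⁻¹' K)) = volume (T ⁻¹' K) :=
    (PiLp.volume_preserving_toLp (Fin m)).measure_preimage_emb
      (MeasurableEquiv.toLp 2 (Fin m → ℝ)).measurableEmbedding _
  rw [hvol]
  nth_rw 1 [Measure.isAddLeftInvariant_eq_smul
    (Measure.hausdorffMeasure (m : ℝ) : Measure (EuclideanSpace ℝ (Fin m))) volume]
  rfl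

lemma volume_preimage_hyperplaneGraph_lt_top {m : ℕ} {K : Set (EuclideanSpace ℝ (Fin (m + 1)))}
    (hK : IsCompact K) (i : Fin (m + 1)) (a : Fin m → ℝ) :
    volume (hyperplaneGraph i a ⁻¹' K) < ⊤ := by
  have hcont : Continuous fun (y : EuclideanSpace ℝ (Fin (m + 1))) (k : Fin m) =>
      y (i.succAbove k) := by fun_prop
  refine lt_of_le_of_lt (measure_mono fun z hz => ?_) (hK.image hcont).measure_lt_top
  exact ⟨_, hz, by ext k; simp⟩

lemma volume_preimage_hyperplaneGraph_pos {m : ℕ} {K : Set (EuclideanSpace ℝ (Fin (m + 1)))}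
    (hK : 0 ∈ interior K) (i : Fin (m + 1)) (a : Fin m → ℝ) :
    0 < volume (hyperplaneGraph i a ⁻¹' K) :=
  ((isOpen_interior.preimage (continuous_hyperplaneGraph i a)).measure_pos volume
    ⟨0, by simpa using hK⟩).trans_le (measure_mono (Set.preimage_mono interior_subset))

lemma exists_NK_eq (m : ℕ) :
    ∃ c : ℝ, 0 < c ∧ ∀ (K : Set (EuclideanSpace ℝ (Fin (m + 1)))) (i : Fin (m + 1))
      (x : EuclideanSpace ℝ (Fin (m + 1))), 0 < x i →
      NK (m + 1) K x = x i /
        (c * (volume (hyperplaneGraph i (fun k => x (i.succAbove k) / x i) ⁻¹' K)).toReal) := by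
  obtain ⟨c, hc, h⟩ := exists_hausdorffMeasure_section_eq m
  refine ⟨c, hc, fun K i x hx => ?_⟩
  have hx0 : x ≠ 0 := fun h => by simp [h] at hx
  have hpos : 0 < √(1 + ∑ k, (x (i.succAbove k) / x i) ^ 2) := by
    have : 0 ≤ ∑ k, (x (i.succAbove k) / x i) ^ 2 := Finset.sum_nonneg fun k _ => sq_nonneg _
    positivity
  have hm : ((m + 1 : ℕ) : ℝ) - 1 = m := by push_cast; ring
  rw [NK, if_neg hx0, sectVol, hm, h K i x hx, norm_eq_mul_sqrt_succAbove hx, ENNReal.toReal_mul,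
    ENNReal.toReal_mul, ENNReal.toReal_ofReal hpos.le, ENNReal.coe_toReal,
    mul_right_comm, mul_div_mul_right _ _ hpos.ne']

lemma NK_le_of_update {m : ℕ} {K : Set (EuclideanSpace ℝ (Fin (m + 1)))}
    (hcpt : IsCompact K) (hconv : Convex ℝ K) (hK_ne : (interior K).Nonempty)
    (hsym : IsOneSymmetric (m + 1) K) {x y : EuclideanSpace ℝ (Fin (m + 1))}
    (hx : ∀ l, 0 ≤ x l) (hx0 : x ≠ 0) (j : Fin (m + 1)) (hxy : ∀ l, l ≠ j → x l = y l)
    (hj : x j ≤ y j) : NK (m + 1) K x ≤ NK (m + 1) K y := by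
  obtain ⟨c, hc, hNK⟩ := exists_NK_eq m
  have h0 := hsym.zero_mem_interior hconv hK_ne
  have hvol : ∀ i a, 0 < (volume (hyperplaneGraph i a ⁻¹' K)).toReal := fun i a =>
    ENNReal.toReal_pos (volume_preimage_hyperplaneGraph_pos h0 i a).ne'
      (volume_preimage_hyperplaneGraph_lt_top hcpt i a).ne
  by_cases hex : ∃ i, i ≠ j ∧ 0 < x i
  · obtain ⟨i, hij, hi⟩ := hex
    obtain ⟨k, rfl⟩ := Fin.exists_succAbove_eq hij.symm
    rw [hNK K i x hi, hNK K i y (hxy i hij ▸ hi), ← hxy i hij]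
    have hpos := hvol i (fun k => y (i.succAbove k) / x i)
    refine div_le_div_of_nonneg_left hi.le (by positivity) ?_
    refine mul_le_mul_of_nonneg_left (ENNReal.toReal_mono
      (volume_preimage_hyperplaneGraph_lt_top hcpt i _).ne ?_) hc.le
    refine volume_preimage_hyperplaneGraph_anti hcpt.isClosed hconv hsym i k (fun l hl => ?_) ?_ ?_
    · rw [hxy _ (fun h => hl (Fin.succAbove_right_injective h))]
    · exact div_nonneg (hx _) hi.le
    · gcongr
  · push Not at hex
    have hz : ∀ k, x (j.succAbove k) = 0 := fun k =>
      le_antisymm (hex _ (Fin.succAbove_ne j k)) (hx _)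
    have hxj : 0 < x j := (hx j).lt_of_ne fun h =>
      hx0 (euclidean_ext_succAbove j h.symm fun k => by simp [hz])
    have hz' : ∀ k, y (j.succAbove k) = 0 := fun k => by
      rw [← hxy _ (Fin.succAbove_ne j k), hz]
    rw [hNK K j x hxj, hNK K j y (hxj.trans_le hj)]
    simp only [hz, hz', zero_div]
    have hpos := hvol j (fun _ => 0)
    gcongr

lemma NK_nonneg (n : ℕ) (K : Set (EuclideanSpace ℝ (Fin n))) (x : EuclideanSpace ℝ (Fin n)) :
    0 ≤ NK n K x := by
  unfold NK
  split_ifs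
  · exact le_rfl
  · exact div_nonneg (norm_nonneg _) ENNReal.toReal_nonneg

lemma NK_mono {n : ℕ} {K : Set (EuclideanSpace ℝ (Fin n))}
    (hcpt : IsCompact K) (hconv : Convex ℝ K) (hK_ne : (interior K).Nonempty)
    (hsym : IsOneSymmetric n K) {x y : EuclideanSpace ℝ (Fin n)}
    (hx : ∀ l, 0 ≤ x l) (hxy : ∀ l, x l ≤ y l) : NK n K x ≤ NK n K y := by
  rcases eq_or_ne x 0 with rfl | hx0
  · simpa [NK] using NK_nonneg n K y
  obtain _ | m := n
  · exact absurd (Subsingleton.elim x 0) hx0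
  set w : Finset (Fin (m + 1)) → EuclideanSpace ℝ (Fin (m + 1)) := fun s =>
    WithLp.toLp 2 fun l => if l ∈ s then y l else x l with hw
  have hxw : ∀ s l, x l ≤ w s l := fun s l => by
    by_cases hl : l ∈ s <;> simp [hw, hl, hxy l]
  have key : ∀ s, NK (m + 1) K x ≤ NK (m + 1) K (w s) := by
    intro s
    induction s using Finset.induction with
    | empty => simp [hw]
    | insert j s hj ih =>
      refine ih.trans (NK_le_of_update hcpt hconv hK_ne hsym (fun l => (hx l).trans (hxw s l))
        (fun h => hx0 ?_) j (fun l hl => by simp [hw, hl]) (by simp [hw, hj, hxy j]))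
      ext l
      exact le_antisymm (by simpa [h] using hxw s l) (hx l)
  simpa [hw] using key Finset.univ

/-- For a 1-symmetric convex body `K`, the Busemann function `N_K` is nondecreasing
in each coordinate on `ℝ₊^n`; in particular its maximum over `[0,1]^n` is attained at
`(1,…,1)`. -/
theorem NK_coordinatewise_monotone (n : ℕ)
    (K : Set (EuclideanSpace ℝ (Fin n)))
    (hK_cpt : IsCompact K) (hK_conv : Convex ℝ K)
    (hK_int : (interior K).Nonempty) (hK_sym : IsOneSymmetric n K) :
    (∀ x y : EuclideanSpace ℝ (Fin n), (∀ j, 0 ≤ x j) → (∀ j, x j ≤ y j) →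
        NK n K x ≤ NK n K y) ∧
    IsGreatest (NK n K '' {x : EuclideanSpace ℝ (Fin n) | ∀ j, x j ∈ Set.Icc (0:ℝ) 1})
      (NK n K (WithLp.toLp 2 (fun _ => 1) : EuclideanSpace ℝ (Fin n))) := by
  refine ⟨fun x y hx hxy => NK_mono hK_cpt hK_conv hK_int hK_sym hx hxy, ⟨_, ?_, rfl⟩, ?_⟩
  · simp
  · rintro _ ⟨x, hx, rfl⟩
    exact NK_mono hK_cpt hK_conv hK_int hK_sym (fun j => (hx j).1) fun j => (hx j).2
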